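/- For any n-ary Boolean function f, the composition f ∗ ⊕₃ (substituting the ternary sum x₁+x₂+x₃ into the first argument of f) equals ⊕₃(f_{σ₁}, f_{σ₂}, f_{σ₃}), where σ_i : [n] → [n+2] maps 1 to i and j to j+2 for 2 ≤ j ≤ n. Consequently, a class F of Boolean functions satisfies F·Λ_c ⊆ F and Λ_c·F ⊆ F with respect to the clone generated by ⊕₃ if and only if F is minor-closed and closed under triple sums f + g + h of equal-arity members. -/

import Mathlib

/-- A Boolean function of arity `n`. -/
abbrev Bf (n : ℕ) := (Fin n → ZMod 2) → ZMod 2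

/-- The Zhegalkin coefficient of the monomial `x_S` of `f`, via Möbius inversion. -/
def zCoeff {n : ℕ} (f : Bf n) (S : Finset (Fin n)) : ZMod 2 :=
  ∑ T ∈ S.powerset, f fun i => if i ∈ T then 1 else 0

/-- The set of monomials of the Zhegalkin polynomial of `f`. -/
def monomials {n : ℕ} (f : Bf n) : Finset (Finset (Fin n)) :=
  Finset.univ.filter fun S => zCoeff f S = 1

/-- Finitary Boolean functions, with positive arity. -/
abbrev OpSig := Σ n : ℕ, Bf (n + 1)

/-- Composition of function classes. -/
def classComp (F K : Set OpSig) : Set OpSig :=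
  { h | ∃ (n m : ℕ) (f : Bf (n + 1)) (g : Fin (n + 1) → Bf (m + 1)),
      (⟨n, f⟩ : OpSig) ∈ F ∧ (∀ i, (⟨m, g i⟩ : OpSig) ∈ K) ∧
      h = ⟨m, fun a => f fun i => g i a⟩ }

/-- A clone: contains all projections and is closed under composition. -/
def IsClone (C : Set OpSig) : Prop :=
  (∀ (n : ℕ) (i : Fin (n + 1)), (⟨n, fun a => a i⟩ : OpSig) ∈ C) ∧
    classComp C C ⊆ C

/-- The ternary sum `⊕₃`. -/
def plus3 : Bf 3 := fun a => a 0 + a 1 + a 2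

/-- The clone `L_c` generated by `⊕₃`: the smallest clone containing `⊕₃`. -/
def Lc : Set OpSig :=
  ⋂₀ { C : Set OpSig | IsClone C ∧ (⟨2, plus3⟩ : OpSig) ∈ C }

/-- The minor formation map `σ_i : [n] → [n+2]`, sending the first index to
`i` and shifting the remaining indices by `2`. -/
def sigma3 (n : ℕ) (i : Fin 3) (j : Fin (n + 1)) : Fin (n + 3) :=
  if (j : ℕ) = 0 then ⟨(i : ℕ), by omega⟩ else ⟨(j : ℕ) + 2, by omega⟩

/-- Functions built from projections by triple sums. -/
inductive OddSum (m : ℕ) : Bf (m + 1) → Prop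
  | proj (i : Fin (m + 1)) : OddSum m (fun a => a i)
  | add3 (u v w : Bf (m + 1)) : OddSum m u → OddSum m v → OddSum m w →
      OddSum m (fun a => u a + v a + w a)

theorem Lc_clone : IsClone Lc := by
  constructor
  · intro n i C hC
    exact hC.1.1 n i
  · rintro _ ⟨n, m, f, g, hf, hg, rfl⟩ C hC
    exact hC.1.2 ⟨n, m, f, g, hf C hC, fun i => hg i C hC, rfl⟩

theorem plus3_mem_Lc : (⟨2, plus3⟩ : OpSig) ∈ Lc := fun _ hC => hC.2

theorem OddSum.comp {n m : ℕ} {f : Bf (n + 1)} (hf : OddSum n f)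
    (g : Fin (n + 1) → Bf (m + 1)) (hg : ∀ i, OddSum m (g i)) :
    OddSum m (fun a => f fun i => g i a) := by
  induction hf with
  | proj i => exact hg i
  | add3 u v w _ _ _ hu hv hw => exact OddSum.add3 _ _ _ hu hv hw

theorem Lc_oddSum {m : ℕ} {g : Bf (m + 1)} (hg : (⟨m, g⟩ : OpSig) ∈ Lc) : OddSum m g := by
  refine hg {h | OddSum h.1 h.2} ⟨⟨fun n i => OddSum.proj i, ?_⟩, ?_⟩
  · rintro _ ⟨n, m, f, g, hf, hg, rfl⟩
    exact OddSum.comp hf g hg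
  · exact OddSum.add3 _ _ _ (OddSum.proj 0) (OddSum.proj 1) (OddSum.proj 2)

/-- Every unary Boolean function is affine. -/
theorem unary_affine : ∀ (φ : ZMod 2 → ZMod 2) (x y z : ZMod 2),
    φ (x + y + z) = φ x + φ y + φ z := by decide

theorem right_stable (F : Set OpSig)
    (hmin : ∀ (n m : ℕ) (f : Bf (n + 1)) (σ : Fin (n + 1) → Fin (m + 1)),
          (⟨n, f⟩ : OpSig) ∈ F → (⟨m, fun a => f fun i => a (σ i)⟩ : OpSig) ∈ F)
    (hsum : ∀ (n : ℕ) (f g h : Bf (n + 1)),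
          (⟨n, f⟩ : OpSig) ∈ F → (⟨n, g⟩ : OpSig) ∈ F → (⟨n, h⟩ : OpSig) ∈ F →
          (⟨n, fun a => f a + g a + h a⟩ : OpSig) ∈ F)
    {n m : ℕ} (f : Bf (n + 1)) (hf : (⟨n, f⟩ : OpSig) ∈ F) (S : Finset (Fin (n + 1))) :
    ∀ g : Fin (n + 1) → Bf (m + 1), (∀ i ∈ S, OddSum m (g i)) →
      (∀ i ∉ S, ∃ k, g i = fun a => a k) →
      (⟨m, fun a => f fun i => g i a⟩ : OpSig) ∈ F := by
  induction S using Finset.induction_on with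
  | empty =>
    intro g _ hg
    choose σ hσ using fun i => hg i (Finset.notMem_empty i)
    have := hmin n m f σ hf
    simpa only [hσ] using this
  | insert j S hj ih =>
    intro g hg1 hg2
    have key : ∀ u : Bf (m + 1), OddSum m u →
        (⟨m, fun a => f (Function.update (fun i => g i a) j (u a))⟩ : OpSig) ∈ F := by
      intro u hu
      induction hu with
      | proj k =>
        have := ih (Function.update g j (fun a => a k)) (fun i hi => by
          have hij : i ≠ j := by rintro rfl; exact hj hi
          rw [Function.update_of_ne hij]
          exact hg1 i (Finset.mem_insert_of_mem hi)) (fun i hi => by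
          by_cases hij : i = j
          · subst hij
            exact ⟨k, by simp⟩
          · rw [Function.update_of_ne hij]
            exact hg2 i (by simp [hij, hi]))
        convert this using 5 with a i
        by_cases hij : i = j
        · subst hij; simp
        · simp [hij]
      | add3 u v w _ _ _ hu hv hw =>
        have := hsum m _ _ _ hu hv hw
        convert this using 3 with a
        exact unary_affine (fun x => f (Function.update (fun i => g i a) j x)) (u a) (v a) (w a)
    simpa using key (g j) (hg1 j (Finset.mem_insert_self j S))

/-- `f ∗ ⊕₃ = ⊕₃(f_{σ₁}, f_{σ₂}, f_{σ₃})`; consequently, a class `F` is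
stable under right and left composition with the clone generated by `⊕₃`
iff `F` is minor-closed and closed under triple sums of equal-arity members. -/
theorem star_plus3_and_Lc_stability :
    (∀ (n : ℕ) (f : Bf (n + 1)) (a : Fin (n + 3) → ZMod 2),
      f (fun j => if (j : ℕ) = 0 then a 0 + a 1 + a 2
            else a ⟨(j : ℕ) + 2, by omega⟩)
        = ∑ i : Fin 3, f (fun j => a (sigma3 n i j))) ∧
    (∀ F : Set OpSig,
      (classComp F Lc ⊆ F ∧ classComp Lc F ⊆ F) ↔
      ((∀ (n m : ℕ) (f : Bf (n + 1)) (σ : Fin (n + 1) → Fin (m + 1)),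
          (⟨n, f⟩ : OpSig) ∈ F → (⟨m, fun a => f fun i => a (σ i)⟩ : OpSig) ∈ F) ∧
       (∀ (n : ℕ) (f g h : Bf (n + 1)),
          (⟨n, f⟩ : OpSig) ∈ F → (⟨n, g⟩ : OpSig) ∈ F → (⟨n, h⟩ : OpSig) ∈ F →
          (⟨n, fun a => f a + g a + h a⟩ : OpSig) ∈ F))) := by
  refine ⟨?_, ?_⟩
  · intro n f a
    have h := unary_affine (fun x => f (fun j => if (j : ℕ) = 0 then x
            else a ⟨(j : ℕ) + 2, by omega⟩)) (a 0) (a 1) (a 2)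
    rw [Fin.sum_univ_three]
    refine h.trans ?_
    congr 1
    · congr 1
      all_goals
        refine congrArg f (funext fun j => ?_)
        unfold sigma3
        split_ifs <;> rfl
    · refine congrArg f (funext fun j => ?_)
      unfold sigma3
      split_ifs <;> rfl
  · intro F
    constructor
    · rintro ⟨hr, hl⟩
      refine ⟨fun n m f σ hf => hr ⟨n, m, f, fun i a => a (σ i), hf,
        fun i => Lc_clone.1 m (σ i), rfl⟩, fun n f g h hf hg hh => ?_⟩
      refine hl ⟨2, n, plus3, ![f, g, h], plus3_mem_Lc, ?_, rfl⟩
      intro i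
      fin_cases i
      · exact hf
      · exact hg
      · exact hh
    · rintro ⟨hmin, hsum⟩
      constructor
      · rintro _ ⟨n, m, f, g, hf, hg, rfl⟩
        exact right_stable F hmin hsum f hf Finset.univ g (fun i _ => Lc_oddSum (hg i))
          (fun i hi => absurd (Finset.mem_univ i) hi)
      · rintro _ ⟨n, m, f, g, hf, hg, rfl⟩
        replace hf := Lc_oddSum hf
        induction hf with
        | proj i => exact hg i
        | add3 u v w h1 h2 h3 hu hv hw => exact hsum m _ _ _ hu hv hw
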